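/- Slice-independence of the H²(𝔹) inner product: let a, b : ℕ → ℍ satisfy ∑_{n≥0} ‖a_n‖² < ∞ and ∑_{n≥0} ‖b_n‖² < ∞, and let f(q) = ∑_{n≥0} qⁿ·a_n and g(q) = ∑_{n≥0} qⁿ·b_n for q in the open unit ball 𝔹 of ℍ. Then for every imaginary unit I, lim_{r→1⁻} (1/(2π))·∫₀^{2π} conj(g(r·e^{Iθ}))·f(r·e^{Iθ}) dθ = ∑_{n≥0} conj(b_n)·a_n, the series on the right being absolutely convergent; in particular the limit is the same for every imaginary unit I. -/

import Mathlib

open scoped Real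
noncomputable section

/-- `e^{Iθ} = cos θ + (sin θ)•I`. -/
def expI (I : Quaternion ℝ) (θ : ℝ) : Quaternion ℝ :=
  (Real.cos θ : Quaternion ℝ) + Real.sin θ • I

section ImaginaryUnit

variable {I : Quaternion ℝ}

theorem norm_eq_one_of_sq_eq_neg_one (hI : I ^ 2 = -1) : ‖I‖ = 1 := by
  have h : ‖I‖ ^ 2 = 1 := by rw [← norm_pow, hI, norm_neg, norm_one]
  exact (pow_eq_one_iff_of_nonneg (norm_nonneg I) two_ne_zero).1 h

theorem star_eq_neg_of_sq_eq_neg_one (hI : I ^ 2 = -1) : star I = -I := by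
  rw [Quaternion.star_eq_neg, ← Quaternion.sq_eq_neg_normSq, hI,
    Quaternion.normSq_eq_norm_mul_self, norm_eq_one_of_sq_eq_neg_one hI]
  simp

theorem expI_eq_smul_one_add (I : Quaternion ℝ) (t : ℝ) :
    expI I t = Real.cos t • (1 : Quaternion ℝ) + Real.sin t • I := by
  simp [expI, ← Quaternion.coe_mul_eq_smul]

theorem expI_add (hI : I ^ 2 = -1) (s t : ℝ) : expI I (s + t) = expI I s * expI I t := by
  have h : I * I = -1 := by rw [← sq, hI]
  simp only [expI_eq_smul_one_add, Real.cos_add, Real.sin_add, add_mul, mul_add, smul_mul_assoc,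
    mul_smul_comm, h, mul_one, one_mul]
  module

theorem expI_zero (I : Quaternion ℝ) : expI I 0 = 1 := by simp [expI]

theorem expI_pow (hI : I ^ 2 = -1) (t : ℝ) (n : ℕ) : expI I t ^ n = expI I (n * t) := by
  induction n with
  | zero => simp [expI_zero]
  | succ n ih => rw [pow_succ, ih, ← expI_add hI]; congr 1; push_cast; ring

theorem star_expI (hI : I ^ 2 = -1) (t : ℝ) : star (expI I t) = expI I (-t) := by
  simp [expI, star_eq_neg_of_sq_eq_neg_one hI]

theorem norm_expI (hI : I ^ 2 = -1) (t : ℝ) : ‖expI I t‖ = 1 := by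
  have h : star (expI I t) * expI I t = 1 := by
    rw [star_expI hI, ← expI_add hI, neg_add_cancel, expI_zero]
  have hn : ‖expI I t‖ ^ 2 = 1 := by
    rw [sq, ← norm_one (α := Quaternion ℝ), ← h, norm_mul, Quaternion.norm_star]
  exact (pow_eq_one_iff_of_nonneg (norm_nonneg _) two_ne_zero).1 hn

theorem continuous_expI (I : Quaternion ℝ) : Continuous (expI I) := by
  unfold expI
  exact (Quaternion.continuous_coe.comp Real.continuous_cos).add
    (Real.continuous_sin.smul continuous_const)

theorem integral_expI_int_mul (I : Quaternion ℝ) {k : ℤ} (hk : k ≠ 0) :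
    ∫ θ in (0 : ℝ)..(2 * π), expI I (k * θ) = 0 := by
  have hk' : (k : ℝ) ≠ 0 := by exact_mod_cast hk
  have hcos : ∫ θ in (0 : ℝ)..(2 * π), Real.cos (k * θ) = 0 := by
    rw [intervalIntegral.integral_comp_mul_left _ hk', integral_cos]
    have h : Real.sin (k * (2 * π)) = 0 := by
      simpa [mul_assoc] using Real.sin_int_mul_pi (k * 2)
    simp [h]
  have hsin : ∫ θ in (0 : ℝ)..(2 * π), Real.sin (k * θ) = 0 := by
    rw [intervalIntegral.integral_comp_mul_left _ hk', integral_sin]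
    simp [Real.cos_int_mul_two_pi]
  simp only [expI_eq_smul_one_add]
  rw [intervalIntegral.integral_add
    (Continuous.intervalIntegrable (by fun_prop) _ _)
    (Continuous.intervalIntegrable (by fun_prop) _ _),
    intervalIntegral.integral_smul_const, intervalIntegral.integral_smul_const, hcos, hsin]
  simp

theorem star_pow_mul_mul_pow_mul (hI : I ^ 2 = -1) (x y : Quaternion ℝ) (r θ : ℝ) (m n : ℕ) :
    star ((r • expI I θ) ^ m * y) * ((r • expI I θ) ^ n * x) =
      r ^ (m + n) • (star y * expI I (((n : ℤ) - m : ℤ) * θ) * x) := by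
  have h : expI I (((n : ℤ) - m : ℤ) * θ) = expI I (-(m * θ)) * expI I (n * θ) := by
    rw [← expI_add hI]; congr 1; push_cast; ring
  rw [h, smul_pow, smul_pow, expI_pow hI, expI_pow hI, star_mul, Quaternion.star_smul,
    star_expI hI]
  simp only [smul_mul_assoc, mul_smul_comm, smul_smul, mul_assoc, pow_add]
  rw [mul_comm]

/-- Distinct monomials are orthogonal on every circle of a slice. -/
theorem integral_star_pow_mul_mul_pow_mul (hI : I ^ 2 = -1) (x y : Quaternion ℝ) (r : ℝ)
    (m n : ℕ) :
    ∫ θ in (0 : ℝ)..(2 * π), star ((r • expI I θ) ^ m * y) * ((r • expI I θ) ^ n * x) =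
      if m = n then (2 * π) • (r ^ (m + n) • (star y * x)) else 0 := by
  simp only [star_pow_mul_mul_pow_mul hI]
  split_ifs with h
  · subst h
    simp [expI_zero, smul_comm (2 * π)]
  · have hint : IntervalIntegrable (fun θ : ℝ => expI I (((n : ℤ) - m : ℤ) * θ))
        MeasureTheory.volume 0 (2 * π) :=
      ((continuous_expI I).comp (by fun_prop)).intervalIntegrable _ _
    let L : Quaternion ℝ →L[ℝ] Quaternion ℝ :=
      (ContinuousLinearMap.mul ℝ (Quaternion ℝ)).flip x ∘L
        ContinuousLinearMap.mul ℝ (Quaternion ℝ) (star y)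
    have hL := L.intervalIntegral_comp_comm hint
    rw [integral_expI_int_mul I (by omega), map_zero] at hL
    rw [intervalIntegral.integral_smul]
    simpa [L] using Or.inr hL

end ImaginaryUnit

theorem summable_norm_pow_mul {a : ℕ → Quaternion ℝ} (ha : Summable fun n => ‖a n‖ ^ 2)
    {r : ℝ} (hr0 : 0 ≤ r) (hr1 : r < 1) : Summable fun n => r ^ n * ‖a n‖ := by
  have hr : Summable fun n : ℕ => (r ^ 2) ^ n :=
    summable_geometric_of_lt_one (by positivity) (by nlinarith)
  refine Summable.of_nonneg_of_le (fun n => by positivity) (fun n => ?_) (hr.add ha)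
  nlinarith [sq_nonneg (r ^ n - ‖a n‖), sq_nonneg (r ^ n), sq_nonneg (‖a n‖), pow_right_comm r n 2]

theorem summable_norm_star_mul {a b : ℕ → Quaternion ℝ} (ha : Summable fun n => ‖a n‖ ^ 2)
    (hb : Summable fun n => ‖b n‖ ^ 2) : Summable fun n => ‖star (b n) * a n‖ := by
  refine Summable.of_nonneg_of_le (fun n => norm_nonneg _) (fun n => ?_) (ha.add hb)
  rw [norm_mul, Quaternion.norm_star]
  nlinarith [sq_nonneg (‖a n‖ - ‖b n‖), sq_nonneg (‖a n‖), sq_nonneg (‖b n‖)]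

/-- Parseval's identity on the circle of radius `r < 1` in the slice of `I`. -/
theorem hasSum_circle_average {a b : ℕ → Quaternion ℝ} (ha : Summable fun n => ‖a n‖ ^ 2)
    (hb : Summable fun n => ‖b n‖ ^ 2) {I : Quaternion ℝ} (hI : I ^ 2 = -1)
    {r : ℝ} (hr0 : 0 ≤ r) (hr1 : r < 1) :
    HasSum (fun n => r ^ (n + n) • (star (b n) * a n))
      ((1 / (2 * π)) • ∫ θ in (0 : ℝ)..(2 * π),
        star (∑' n, (r • expI I θ) ^ n * b n) * ∑' n, (r • expI I θ) ^ n * a n) := by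
  have hnorm (c : ℕ → Quaternion ℝ) (θ : ℝ) (n : ℕ) :
      ‖(r • expI I θ) ^ n * c n‖ = r ^ n * ‖c n‖ := by
    rw [norm_mul, norm_pow, norm_smul, norm_expI hI, mul_one, Real.norm_of_nonneg hr0]
  have hsa := summable_norm_pow_mul ha hr0 hr1
  have hsb := summable_norm_pow_mul hb hr0 hr1
  have hbound : Summable fun p : ℕ × ℕ => (r ^ p.1 * ‖b p.1‖) * (r ^ p.2 * ‖a p.2‖) :=
    hsb.mul_of_nonneg hsa (fun n => by positivity) (fun n => by positivity)
  have key : HasSum (fun p : ℕ × ℕ => ∫ θ in (0 : ℝ)..(2 * π),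
        star ((r • expI I θ) ^ p.1 * b p.1) * ((r • expI I θ) ^ p.2 * a p.2))
      (∫ θ in (0 : ℝ)..(2 * π),
        star (∑' n, (r • expI I θ) ^ n * b n) * ∑' n, (r • expI I θ) ^ n * a n) := by
    refine intervalIntegral.hasSum_integral_of_dominated_convergence
      (fun p _ => (r ^ p.1 * ‖b p.1‖) * (r ^ p.2 * ‖a p.2‖)) (fun p => ?_)
      (fun p => .of_forall fun θ _ => ?_) (.of_forall fun θ _ => hbound)
      intervalIntegrable_const (.of_forall fun θ _ => ?_)
    · have := continuous_expI I
      exact Continuous.aestronglyMeasurable (by fun_prop)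
    · rw [norm_mul, Quaternion.norm_star, hnorm, hnorm]
    · have h1 : Summable fun n => ‖star ((r • expI I θ) ^ n * b n)‖ := by
        simpa only [Quaternion.norm_star, hnorm] using hsb
      have h2 : Summable fun n => ‖(r • expI I θ) ^ n * a n‖ := by
        simpa only [hnorm] using hsa
      rw [tsum_star, tsum_mul_tsum_of_summable_norm h1 h2]
      exact (summable_mul_of_summable_norm h1 h2).hasSum
  simp only [integral_star_pow_mul_mul_pow_mul hI] at key
  have hinj : Function.Injective fun n : ℕ => (n, n) := fun m n h => (Prod.ext_iff.1 h).1
  have hdiag := ((hinj.hasSum_iff fun p hp => if_neg fun h =>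
    hp ⟨p.1, Prod.ext rfl h⟩).2 key).const_smul (1 / (2 * π))
  convert hdiag using 2 with n
  have hpi : 1 / (2 * π) * (2 * π) = 1 := one_div_mul_cancel (by positivity)
  rw [Function.comp_apply, if_pos rfl, smul_smul, hpi, one_smul]


/-- **Slice-independence of the `H²(𝔹)` inner product**: for `f(q) = ∑ qⁿ a_n` and
`g(q) = ∑ qⁿ b_n` with square-summable coefficients, and any imaginary unit `I`,
`lim_{r→1⁻} (1/(2π))·∫₀^{2π} conj(g(r e^{Iθ}))·f(r e^{Iθ}) dθ = ∑ conj(b_n)·a_n`,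
the series converging absolutely; in particular the limit does not depend on `I`. -/
theorem H2_inner_product_slice_independent
    (a b : ℕ → Quaternion ℝ)
    (ha : Summable (fun n => ‖a n‖ ^ 2)) (hb : Summable (fun n => ‖b n‖ ^ 2))
    (f g : Quaternion ℝ → Quaternion ℝ)
    (hf : ∀ q : Quaternion ℝ, ‖q‖ < 1 → f q = ∑' n : ℕ, q ^ n * a n)
    (hg : ∀ q : Quaternion ℝ, ‖q‖ < 1 → g q = ∑' n : ℕ, q ^ n * b n)
    (I : Quaternion ℝ) (hI : I ^ 2 = -1) :
    Summable (fun n : ℕ => ‖star (b n) * a n‖) ∧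
    Filter.Tendsto (fun r : ℝ =>
        (1 / (2 * π)) • ∫ θ in (0:ℝ)..(2 * π),
          star (g (r • expI I θ)) * f (r • expI I θ))
      (nhdsWithin 1 (Set.Iio 1)) (nhds (∑' n : ℕ, star (b n) * a n)) := by
  have hs := summable_norm_star_mul ha hb
  refine ⟨hs, ?_⟩
  have hr : ∀ᶠ r : ℝ in nhdsWithin 1 (Set.Iio 1), 0 ≤ r ∧ r < 1 :=
    ((eventually_ge_nhds zero_lt_one).filter_mono nhdsWithin_le_nhds).and self_mem_nhdsWithin
  have hlim : Filter.Tendsto (fun r : ℝ => ∑' n : ℕ, r ^ (n + n) • (star (b n) * a n))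
      (nhdsWithin 1 (Set.Iio 1)) (nhds (∑' n : ℕ, star (b n) * a n)) := by
    refine tendsto_tsum_of_dominated_convergence hs (fun n => ?_) ?_
    · have : Continuous fun r : ℝ => r ^ (n + n) • (star (b n) * a n) := by fun_prop
      simpa using (this.tendsto 1).mono_left nhdsWithin_le_nhds
    · filter_upwards [hr] with r hr n
      rw [norm_smul, norm_pow, Real.norm_of_nonneg hr.1]
      exact mul_le_of_le_one_left (norm_nonneg _) (pow_le_one₀ hr.1 hr.2.le)
  refine hlim.congr' ?_
  filter_upwards [hr] with r hr
  have hq (θ : ℝ) : ‖r • expI I θ‖ < 1 := by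
    rw [norm_smul, norm_expI hI, mul_one, Real.norm_of_nonneg hr.1]
    exact hr.2
  simp only [hf _ (hq _), hg _ (hq _)]
  exact (hasSum_circle_average ha hb hI hr.1 hr.2).tsum_eq
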